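/- Let σ : ℝ → ℝ be bounded and differentiable with bounded derivative, let α_n ≥ 1, t_n ≥ L_n > 0, γ*_n ≥ 1, B_n ≥ 1, r ≥ 2d, fix data points (X₁,Y₁),…,(X_n,Y_n) ∈ ℝ^d × ℝ, and let w, v be weight vectors such that |w^{(L)}_{1,1,k}| ≤ γ*_n and |v^{(L)}_{1,1,k}| ≤ γ*_n for k = 1,…,K_n, |w^{(l)}_{k,i,j}| ≤ B_n and |v^{(l)}_{k,i,j}| ≤ B_n for l = 1,…,L−1, and ‖w − v‖_∞² ≤ (2t_n/L_n)·max{F_n(v),1}. Then (1/n)·Σ_{s=1}^n (Y_s − f_w(X_s))²·1_{[−α_n,α_n]^d}(X_s) ≤ 2·F_n(v) + 8·max{‖σ'‖_∞^{2L},1}·K_n²·(γ*_n)²·(2r+1)^{2L}·B_n^{2L}·α_n²·max{‖σ‖_∞,1}²·(2t_n/L_n)·max{F_n(v),1}. -/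

import Mathlib

open MeasureTheory ProbabilityTheory Filter

noncomputable section

/-- The logistic squasher `σ(x) = 1/(1+e^{-x})`. -/
def sigLog : ℝ → ℝ := fun x => 1 / (1 + Real.exp (-x))

/-- Index type for the weights of a linear combination of `Kn` fully connected deep networks
with `L` layers, `r` neurons per layer and input dimension `d`:
`Sum.inl (k, i, j)` is the level-0 weight `w^{(0)}_{k,i+1,j}` (`j = 0` is the bias,
`j = t+1` multiplies `x^{(t+1)}`); `Sum.inr (Sum.inl (k, m, i, j))` is the inner weight
`w^{(m+1)}_{k,i+1,j}` for the levels `m+1 ∈ {1,…,L-1}` (`j = 0` is the bias, `j = t+1`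
multiplies the output of neuron `t+1`); `Sum.inr (Sum.inr j)` is the output weight
`w^{(L)}_{1,1,j+1}`. -/
abbrev Idx (Kn L r d : ℕ) : Type :=
  (Fin Kn × Fin r × Fin (d + 1)) ⊕ ((Fin Kn × Fin (L - 1) × Fin r × Fin (r + 1)) ⊕ Fin Kn)

/-- `hid σ Kn L r d w k m i x` is the output `f^{(m+1)}_{k,i+1}(x)` of neuron `i+1` in
layer `m+1` of the `k`-th fully connected subnetwork. -/
def hid (σ : ℝ → ℝ) (Kn L r d : ℕ) (w : EuclideanSpace ℝ (Idx Kn L r d)) (k : Fin Kn) :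
    ℕ → Fin r → (Fin d → ℝ) → ℝ
  | 0 => fun i x =>
      σ ((∑ j : Fin d, w (Sum.inl (k, i, j.succ)) * x j) + w (Sum.inl (k, i, 0)))
  | (m + 1) => fun i x =>
      σ ((∑ j : Fin r,
            (if h : m < L - 1 then w (Sum.inr (Sum.inl (k, ⟨m, h⟩, i, j.succ))) else 0) *
              hid σ Kn L r d w k m j x) +
          (if h : m < L - 1 then w (Sum.inr (Sum.inl (k, ⟨m, h⟩, i, 0))) else 0))

/-- Output `f^{(L)}_{k,1}` of the `k`-th fully connected subnetwork. -/
def subnet (σ : ℝ → ℝ) (Kn L r d : ℕ) (w : EuclideanSpace ℝ (Idx Kn L r d)) (k : Fin Kn)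
    (x : Fin d → ℝ) : ℝ :=
  if h : 0 < r then hid σ Kn L r d w k (L - 1) ⟨0, h⟩ x else 0

/-- The deep network `f_w(x) = ∑_{j=1}^{K_n} w^{(L)}_{1,1,j} · f^{(L)}_{j,1}(x)`. -/
def netF (σ : ℝ → ℝ) (Kn L r d : ℕ) (w : EuclideanSpace ℝ (Idx Kn L r d))
    (x : Fin d → ℝ) : ℝ :=
  ∑ j : Fin Kn, w (Sum.inr (Sum.inr j)) * subnet σ Kn L r d w j x

/-- Indicator function of the cube `[-α,α]^d`. -/
def cubeInd (d : ℕ) (α : ℝ) (x : Fin d → ℝ) : ℝ :=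
  Set.indicator {y : Fin d → ℝ | ∀ j, |y j| ≤ α} (fun _ => (1 : ℝ)) x

/-- The regularized empirical L₂ risk
`F_n(w) = (1/n) ∑_i |f_w(X_i) - Y_i|² 1_{[-α_n,α_n]^d}(X_i) + c₂ ∑_j |w^{(L)}_{1,1,j}|²`. -/
def empRisk (σ : ℝ → ℝ) (Kn L r d n : ℕ) (X : Fin n → Fin d → ℝ) (Y : Fin n → ℝ)
    (αn c2 : ℝ) (w : EuclideanSpace ℝ (Idx Kn L r d)) : ℝ :=
  (1 / (n : ℝ)) * ∑ i : Fin n, (netF σ Kn L r d w (X i) - Y i) ^ 2 * cubeInd d αn (X i)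
    + c2 * ∑ j : Fin Kn, (w (Sum.inr (Sum.inr j))) ^ 2

/-- Truncation operator `T_β z = max{-β, min{β, z}}`. -/
def Tbeta (β z : ℝ) : ℝ := max (-β) (min β z)

/-- A function with derivative bounded by `D` is `D`-Lipschitz. -/
theorem abs_sub_le_of_abs_deriv_le {σ : ℝ → ℝ} {D : ℝ} (hσ : Differentiable ℝ σ)
    (hD : ∀ x, |deriv σ x| ≤ D) (a b : ℝ) : |σ a - σ b| ≤ D * |a - b| := by
  simpa [Real.norm_eq_abs] using
    Convex.norm_image_sub_le_of_norm_deriv_le (f := σ) (s := Set.univ) (x := b) (y := a)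
      (fun x _ => hσ x) (fun x _ => hD x) convex_univ trivial trivial

/-- Stability of a finite sum of products in both factors. -/
theorem abs_sum_mul_sub_sum_mul_le {ι : Type*} [Fintype ι] {a b f g : ι → ℝ} {A E δ S : ℝ}
    (hA : 0 ≤ A) (hδ : 0 ≤ δ) (ha : ∀ j, |a j| ≤ A) (hfg : ∀ j, |f j - g j| ≤ E)
    (hab : ∀ j, |a j - b j| ≤ δ) (hg : ∀ j, |g j| ≤ S) :
    |∑ j, a j * f j - ∑ j, b j * g j| ≤ Fintype.card ι * (A * E + δ * S) := by
  rw [← Finset.sum_sub_distrib]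
  calc |∑ j, (a j * f j - b j * g j)| ≤ ∑ j, |a j * f j - b j * g j| :=
        Finset.abs_sum_le_sum_abs _ _
    _ ≤ ∑ _j : ι, (A * E + δ * S) := by
        refine Finset.sum_le_sum fun j _ => ?_
        rw [show a j * f j - b j * g j = a j * (f j - g j) + (a j - b j) * g j by ring]
        refine (abs_add_le _ _).trans ?_
        rw [abs_mul, abs_mul]
        exact add_le_add (mul_le_mul (ha j) (hfg j) (abs_nonneg _) hA)
          (mul_le_mul (hab j) (hg j) (abs_nonneg _) hδ)
    _ = Fintype.card ι * (A * E + δ * S) := by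
        rw [Finset.sum_const, Finset.card_univ, nsmul_eq_mul]

section Perturbation

variable {σ : ℝ → ℝ} {Kn L r d : ℕ} {w v : EuclideanSpace ℝ (Idx Kn L r d)}
  {α δ γ B S D : ℝ} {x : Fin d → ℝ}

theorem abs_hid_le (hS : ∀ y, |σ y| ≤ S) (k : Fin Kn) (m : ℕ) (i : Fin r) :
    |hid σ Kn L r d w k m i x| ≤ S := by
  cases m <;> exact hS _

/-- Perturbing the weights by at most `δ` changes layer `m + 1` by at most a constant times `δ`,
the constant growing geometrically in `m`. -/
theorem abs_hid_sub_hid_le (hσ : Differentiable ℝ σ) (hD : ∀ y, |deriv σ y| ≤ D) (hD1 : 1 ≤ D)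
    (hS : ∀ y, |σ y| ≤ S) (hS1 : 1 ≤ S) (hα : 1 ≤ α) (hB : 1 ≤ B) (hdr : d ≤ r) (hδ : 0 ≤ δ)
    (hwin : ∀ (k : Fin Kn) (l : Fin (L - 1)) (i : Fin r) (j : Fin (r + 1)),
      |w (Sum.inr (Sum.inl (k, l, i, j)))| ≤ B)
    (hwv : ∀ idx, |w idx - v idx| ≤ δ) (hx : ∀ j, |x j| ≤ α) (k : Fin Kn) (m : ℕ) (i : Fin r) :
    |hid σ Kn L r d w k m i x - hid σ Kn L r d v k m i x| ≤
      (D * (2 * r + 1) * B) ^ (m + 1) * (α * S * δ) := by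
  have hC : 1 ≤ D * (2 * r + 1) * B :=
    one_le_mul_of_one_le_of_one_le
      (one_le_mul_of_one_le_of_one_le hD1 (by linarith [Nat.cast_nonneg (α := ℝ) r])) hB
  have hSδ : S * δ ≤ α * S * δ := by
    rw [mul_assoc]; exact le_mul_of_one_le_left (by positivity) hα
  induction m generalizing i with
  | zero =>
    have hsum := abs_sum_mul_sub_sum_mul_le (a := fun j : Fin d => x j) (b := fun j => x j)
      (f := fun j => w (Sum.inl (k, i, j.succ))) (g := fun j => v (Sum.inl (k, i, j.succ)))
      (A := α) (E := δ) (δ := 0) (S := ∑ j : Fin d, |v (Sum.inl (k, i, j.succ))|)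
      (by positivity) le_rfl hx (fun j => hwv _) (by simp)
      (fun j => Finset.single_le_sum (f := fun j : Fin d => |v (Sum.inl (k, i, j.succ))|)
        (fun _ _ => abs_nonneg _) (Finset.mem_univ j))
    simp only [Fintype.card_fin, zero_mul, add_zero, mul_comm (x _)] at hsum
    have hdr' : (d : ℝ) ≤ r := by exact_mod_cast hdr
    have hαδ : α * δ ≤ α * S * δ := by
      have := le_mul_of_one_le_right (mul_nonneg (by linarith : 0 ≤ α) hδ) hS1
      linarith
    have hδP : δ ≤ α * S * δ := (le_mul_of_one_le_left hδ hα).trans hαδ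
    refine (abs_sub_le_of_abs_deriv_le hσ hD _ _).trans ?_
    rw [zero_add, pow_one, mul_assoc, mul_assoc]
    refine mul_le_mul_of_nonneg_left ?_ (by linarith)
    rw [add_sub_add_comm]
    refine (abs_add_le _ _).trans ((add_le_add hsum (hwv _)).trans ?_)
    have hP : 0 ≤ α * S * δ := by positivity
    calc (d : ℝ) * (α * δ) + δ ≤ r * (α * S * δ) + α * S * δ := by gcongr
      _ ≤ (2 * r + 1) * (α * S * δ) := by nlinarith [Nat.cast_nonneg (α := ℝ) r]
      _ ≤ (2 * r + 1) * (B * (α * S * δ)) := by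
          exact mul_le_mul_of_nonneg_left (le_mul_of_one_le_left hP hB) (by positivity)
  | succ m ih =>
    set P := (D * (2 * r + 1) * B) ^ (m + 1) * (α * S * δ) with hPdef
    have hSP : S * δ ≤ P :=
      hSδ.trans (le_mul_of_one_le_left (by positivity) (one_le_pow₀ hC))
    have hδP : δ ≤ P := (le_mul_of_one_le_left hδ hS1).trans hSP
    have hP : 0 ≤ P := hδ.trans hδP
    have hweight : ∀ j : Fin (r + 1),
        |(if h : m < L - 1 then w (Sum.inr (Sum.inl (k, ⟨m, h⟩, i, j))) else 0)| ≤ B := by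
      intro j
      split_ifs
      · exact hwin _ _ _ _
      · simp only [abs_zero]; linarith
    have hdiff : ∀ j : Fin (r + 1),
        |(if h : m < L - 1 then w (Sum.inr (Sum.inl (k, ⟨m, h⟩, i, j))) else 0) -
          (if h : m < L - 1 then v (Sum.inr (Sum.inl (k, ⟨m, h⟩, i, j))) else 0)| ≤ δ := by
      intro j
      split_ifs
      · exact hwv _
      · simpa using hδ
    have hsum := abs_sum_mul_sub_sum_mul_le (by linarith) hδ (fun j : Fin r => hweight j.succ) ih
      (fun j => hdiff j.succ) (fun j => abs_hid_le (w := v) (x := x) hS k m j)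
    rw [Fintype.card_fin] at hsum
    refine (abs_sub_le_of_abs_deriv_le hσ hD _ _).trans ?_
    rw [pow_succ', mul_assoc, ← hPdef, mul_assoc, mul_assoc]
    refine mul_le_mul_of_nonneg_left ?_ (by linarith)
    rw [add_sub_add_comm]
    refine (abs_add_le _ _).trans ((add_le_add hsum (hdiff 0)).trans ?_)
    have hBP : P ≤ B * P := le_mul_of_one_le_left hP hB
    have hSBP : δ * S ≤ B * P := by linarith
    have hδBP : δ ≤ B * P := hδP.trans hBP
    calc (r : ℝ) * (B * P + δ * S) + δ ≤ r * (B * P + B * P) + B * P := by gcongr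
      _ = (2 * r + 1) * (B * P) := by ring

theorem abs_netF_sub_netF_le (hσ : Differentiable ℝ σ) (hD : ∀ y, |deriv σ y| ≤ D)
    (hD1 : 1 ≤ D) (hS : ∀ y, |σ y| ≤ S) (hS1 : 1 ≤ S) (hα : 1 ≤ α) (hB : 1 ≤ B) (hγ : 1 ≤ γ)
    (hdr : d ≤ r) (hL : 1 ≤ L) (hδ : 0 ≤ δ)
    (hwout : ∀ k : Fin Kn, |w (Sum.inr (Sum.inr k))| ≤ γ)
    (hwin : ∀ (k : Fin Kn) (l : Fin (L - 1)) (i : Fin r) (j : Fin (r + 1)),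
      |w (Sum.inr (Sum.inl (k, l, i, j)))| ≤ B)
    (hwv : ∀ idx, |w idx - v idx| ≤ δ) (hx : ∀ j, |x j| ≤ α) :
    |netF σ Kn L r d w x - netF σ Kn L r d v x| ≤
      2 * Kn * γ * ((D * (2 * r + 1) * B) ^ L * (α * S * δ)) := by
  have hC : 1 ≤ D * (2 * r + 1) * B :=
    one_le_mul_of_one_le_of_one_le
      (one_le_mul_of_one_le_of_one_le hD1 (by linarith [Nat.cast_nonneg (α := ℝ) r])) hB
  set P := (D * (2 * r + 1) * B) ^ L * (α * S * δ) with hPdef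
  have hSP : δ * S ≤ P := by
    refine le_trans ?_ (le_mul_of_one_le_left (by positivity) (one_le_pow₀ hC))
    rw [mul_assoc, mul_comm δ]
    exact le_mul_of_one_le_left (by positivity) hα
  have hP : 0 ≤ P := by positivity
  have hsub : ∀ k, |subnet σ Kn L r d w k x - subnet σ Kn L r d v k x| ≤ P := by
    intro k
    unfold subnet
    split_ifs with h
    · simpa [Nat.sub_add_cancel hL] using
        abs_hid_sub_hid_le hσ hD hD1 hS hS1 hα hB hdr hδ hwin hwv hx k (L - 1) ⟨0, h⟩
    · simpa using hP
  have hbdd : ∀ k, |subnet σ Kn L r d v k x| ≤ S := by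
    intro k
    unfold subnet
    split_ifs
    · exact abs_hid_le hS _ _ _
    · simp only [abs_zero]; linarith
  refine (abs_sum_mul_sub_sum_mul_le (by linarith) hδ hwout hsub (fun k => hwv _) hbdd).trans ?_
  rw [Fintype.card_fin]
  have hSγP : δ * S ≤ γ * P := hSP.trans (le_mul_of_one_le_left hP hγ)
  calc (Kn : ℝ) * (γ * P + δ * S) ≤ Kn * (γ * P + γ * P) := by gcongr
    _ = 2 * Kn * γ * P := by ring

end Perturbation

/-- If two networks differ by at most `Q` on the cube, their empirical risks are comparable. -/
theorem empirical_risk_le_two_mul_empRisk_add {σ : ℝ → ℝ} {Kn L r d n : ℕ}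
    {X : Fin n → Fin d → ℝ} {Y : Fin n → ℝ} {α c Q : ℝ} (hc : 0 ≤ c)
    {w v : EuclideanSpace ℝ (Idx Kn L r d)}
    (h : ∀ x : Fin d → ℝ, (∀ j, |x j| ≤ α) →
      |netF σ Kn L r d w x - netF σ Kn L r d v x| ≤ Q) :
    (1 / (n : ℝ)) * ∑ s : Fin n, (Y s - netF σ Kn L r d w (X s)) ^ 2 * cubeInd d α (X s) ≤
      2 * empRisk σ Kn L r d n X Y α c v + 2 * Q ^ 2 := by
  have hterm : ∀ s, (Y s - netF σ Kn L r d w (X s)) ^ 2 * cubeInd d α (X s) ≤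
      2 * ((netF σ Kn L r d v (X s) - Y s) ^ 2 * cubeInd d α (X s)) + 2 * Q ^ 2 := by
    intro s
    unfold cubeInd
    by_cases hs : X s ∈ {y : Fin d → ℝ | ∀ j, |y j| ≤ α}
    · rw [Set.indicator_of_mem hs, mul_one, mul_one]
      have hsq := sq_le_sq' (abs_le.1 (h _ hs)).1 (abs_le.1 (h _ hs)).2
      nlinarith [sq_nonneg (netF σ Kn L r d w (X s) + Y s - 2 * netF σ Kn L r d v (X s))]
    · rw [Set.indicator_of_notMem hs]
      nlinarith [sq_nonneg Q]
  have hpen : 0 ≤ c * ∑ j : Fin Kn, (v (Sum.inr (Sum.inr j))) ^ 2 := by positivity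
  have hn : (1 / (n : ℝ)) * n ≤ 1 := by rw [one_div]; exact inv_mul_le_one
  have hsum := mul_le_mul_of_nonneg_left (Finset.sum_le_sum fun s (_ : s ∈ Finset.univ) => hterm s)
    (by positivity : 0 ≤ 1 / (n : ℝ))
  rw [Finset.sum_add_distrib, ← Finset.mul_sum, Finset.sum_const, Finset.card_univ,
    Fintype.card_fin, nsmul_eq_mul] at hsum
  unfold empRisk
  nlinarith [mul_le_mul_of_nonneg_right hn (by positivity : 0 ≤ 2 * Q ^ 2)]

/-- Bound on the empirical L₂ risk of `w` in terms of the regularized empirical L₂ risk of a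
nearby weight vector `v`. -/
theorem empirical_risk_perturbation_bound
    (d r L Kn n : ℕ) (hd : 0 < d) (hKn : 0 < Kn) (hL : 2 ≤ L) (hr : 2 * d ≤ r)
    (σ : ℝ → ℝ) (hσdiff : Differentiable ℝ σ)
    (hσbdd : ∃ M, ∀ x, |σ x| ≤ M) (hσ'bdd : ∃ M, ∀ x, |deriv σ x| ≤ M)
    (c2 : ℝ) (hc2 : 0 < c2)
    (X : Fin n → Fin d → ℝ) (Y : Fin n → ℝ)
    (αn tn Ln γ B : ℝ) (hα : 1 ≤ αn) (hLn : 0 < Ln) (htn : Ln ≤ tn)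
    (hγ : 1 ≤ γ) (hB : 1 ≤ B)
    (w v : EuclideanSpace ℝ (Idx Kn L r d))
    (hwout : ∀ k : Fin Kn, |w (Sum.inr (Sum.inr k))| ≤ γ)
    (hvout : ∀ k : Fin Kn, |v (Sum.inr (Sum.inr k))| ≤ γ)
    (hwin : ∀ (k : Fin Kn) (l : Fin (L - 1)) (i : Fin r) (j : Fin (r + 1)),
      |w (Sum.inr (Sum.inl (k, l, i, j)))| ≤ B)
    (hvin : ∀ (k : Fin Kn) (l : Fin (L - 1)) (i : Fin r) (j : Fin (r + 1)),
      |v (Sum.inr (Sum.inl (k, l, i, j)))| ≤ B)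
    (hclose : (⨆ idx : Idx Kn L r d, |w idx - v idx|) ^ 2 ≤
      2 * tn / Ln * max (empRisk σ Kn L r d n X Y αn c2 v) 1) :
    (1 / (n : ℝ)) * ∑ s : Fin n, (Y s - netF σ Kn L r d w (X s)) ^ 2 * cubeInd d αn (X s) ≤
      2 * empRisk σ Kn L r d n X Y αn c2 v +
        8 * max ((⨆ y, |deriv σ y|) ^ (2 * L)) 1 * Kn ^ 2 * γ ^ 2 * (2 * r + 1) ^ (2 * L) *
          B ^ (2 * L) * αn ^ 2 * max (⨆ y, |σ y|) 1 ^ 2 *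
          (2 * tn / Ln) * max (empRisk σ Kn L r d n X Y αn c2 v) 1 := by
  have hidx : ∀ idx, |w idx - v idx| ≤ ⨆ idx : Idx Kn L r d, |w idx - v idx| :=
    le_ciSup (f := fun idx => |w idx - v idx|) (Set.finite_range _).bddAbove
  have hσS : ∀ y, |σ y| ≤ max (⨆ y, |σ y|) 1 := by
    obtain ⟨M, hM⟩ := hσbdd
    exact fun y => (le_ciSup (f := fun y => |σ y|) ⟨M, Set.forall_mem_range.2 hM⟩ y).trans
      (le_max_left _ _)
  have hσD : ∀ y, |deriv σ y| ≤ max (⨆ y, |deriv σ y|) 1 := by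
    obtain ⟨M, hM⟩ := hσ'bdd
    exact fun y => (le_ciSup (f := fun y => |deriv σ y|) ⟨M, Set.forall_mem_range.2 hM⟩ y).trans
      (le_max_left _ _)
  have hδ : 0 ≤ ⨆ idx : Idx Kn L r d, |w idx - v idx| := Real.iSup_nonneg fun _ => abs_nonneg _
  have hD0 : 0 ≤ ⨆ y, |deriv σ y| := Real.iSup_nonneg fun _ => abs_nonneg _
  have hmax : max ((⨆ y, |deriv σ y|) ^ (2 * L)) 1 = max (⨆ y, |deriv σ y|) 1 ^ (2 * L) := by
    rcases le_total (⨆ y, |deriv σ y|) 1 with h | h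
    · rw [max_eq_right h, max_eq_right (pow_le_one₀ hD0 h), one_pow]
    · rw [max_eq_left h, max_eq_left (one_le_pow₀ h)]
  rw [hmax]
  refine (empirical_risk_le_two_mul_empRisk_add hc2.le fun x hx =>
    abs_netF_sub_netF_le hσdiff hσD (le_max_right _ _) hσS (le_max_right _ _) hα hB hγ
      (by omega) (by omega) hδ hwout hwin hidx hx).trans (add_le_add_right ?_ _)
  generalize max (⨆ y, |deriv σ y|) 1 = D
  generalize max (⨆ y, |σ y|) 1 = S
  generalize max (empRisk σ Kn L r d n X Y αn c2 v) 1 = F at hclose ⊢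
  generalize (⨆ idx : Idx Kn L r d, |w idx - v idx|) = δ at hclose
  have hnn : 0 ≤ 8 * D ^ (2 * L) * Kn ^ 2 * γ ^ 2 * (2 * r + 1) ^ (2 * L) * B ^ (2 * L) *
      αn ^ 2 * S ^ 2 := by
    simp only [pow_mul]; positivity
  calc _ = 8 * D ^ (2 * L) * Kn ^ 2 * γ ^ 2 * (2 * r + 1) ^ (2 * L) * B ^ (2 * L) *
        αn ^ 2 * S ^ 2 * δ ^ 2 := by
        simp only [mul_pow, ← pow_mul, mul_comm L 2]; ring
    _ ≤ _ := mul_le_mul_of_nonneg_left hclose hnn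
    _ = _ := by ring

end
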